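/- The normal modal logic generated by the S4 axioms (□p→p and □p→□□p) together with the axiom Grz* is equal to Grzegorczyk logic Grz. Consequently, Grz is the smallest normal modal logic containing S4 in which every contingency possibly attains a penultimate truth-value. -/

import Mathlib

namespace GrzPaper

/-- Propositional modal formulas, built from variables, falsum, implication and box. -/
inductive Formula : Type
  | var : ℕ → Formula
  | fls : Formula
  | impl : Formula → Formula → Formula
  | box : Formula → Formula
deriving DecidableEq

namespace Formula

def neg (φ : Formula) : Formula := impl φ fls
def tru : Formula := neg fls
def disj (φ ψ : Formula) : Formula := impl (neg φ) ψ
def conj (φ ψ : Formula) : Formula := neg (impl φ (neg ψ))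
def dia (φ : Formula) : Formula := neg (box (neg φ))

/-- Uniform substitution. -/
def subst (σ : ℕ → Formula) : Formula → Formula
  | var n => σ n
  | fls => fls
  | impl a b => impl (subst σ a) (subst σ b)
  | box a => box (subst σ a)

/-- Propositional (Boolean) evaluation, treating variables and boxed formulas as atoms. -/
def evalProp (v : Formula → Bool) : Formula → Bool
  | var n => v (var n)
  | fls => false
  | impl a b => !(evalProp v a) || evalProp v b
  | box a => v (box a)

/-- A propositional tautology: true under every Boolean valuation of the atoms
(variables and boxed subformulas). -/
def Tautology (φ : Formula) : Prop := ∀ v, evalProp v φ = true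

end Formula

open Formula

/-- A normal modal logic: contains all propositional tautologies and all instances of K,
closed under modus ponens, necessitation and uniform substitution. -/
structure IsNormalLogic (L : Set Formula) : Prop where
  taut : ∀ φ, Tautology φ → φ ∈ L
  axK : ∀ φ ψ, impl (box (impl φ ψ)) (impl (box φ) (box ψ)) ∈ L
  mp : ∀ φ ψ, impl φ ψ ∈ L → φ ∈ L → ψ ∈ L
  nec : ∀ φ, φ ∈ L → box φ ∈ L
  subst : ∀ φ σ, φ ∈ L → φ.subst σ ∈ L

/-- The normal modal logic generated by a set of axioms: the smallest normal modal
logic containing them. -/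
def Generated (Ax : Set Formula) : Set Formula :=
  ⋂₀ {L | IsNormalLogic L ∧ Ax ⊆ L}

def pv : Formula := var 0
def qv : Formula := var 1

def axT : Formula := impl (box pv) pv
def axFour : Formula := impl (box pv) (box (box pv))
def axGrz : Formula := impl (box (impl (box (impl pv (box pv))) pv)) pv
def axPoint2 : Formula := impl (dia (box pv)) (box (dia pv))
def axPoint3 : Formula := disj (box (impl (box pv) qv)) (box (impl (box qv) pv))

/-- penultimate(φ) : φ ∧ ◇¬φ ∧ □(¬φ → □¬φ). -/
def penultimate (φ : Formula) : Formula :=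
  conj φ (conj (dia (neg φ)) (box (impl (neg φ) (box (neg φ)))))

/-- contingent(φ) : ◇φ ∧ ◇¬φ. -/
def contingent (φ : Formula) : Formula := conj (dia φ) (dia (neg φ))

/-- The axiom Grz* : contingent(p) → ◇(penultimate(p) ∨ penultimate(¬p)). -/
def axGrzStar : Formula :=
  impl (contingent pv) (dia (disj (penultimate pv) (penultimate (neg pv))))

def Grz : Set Formula := Generated {axGrz}
def GrzStarLogic : Set Formula := Generated {axGrzStar}
def S4GrzStar : Set Formula := Generated {axT, axFour, axGrzStar}
def Grz2 : Set Formula := Generated {axGrz, axPoint2}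
def Grz3 : Set Formula := Generated {axGrz, axPoint3}
def KLogic : Set Formula := Generated ∅

/-- A Kripke model: an accessibility relation together with a valuation. -/
structure KripkeModel (W : Type) where
  rel : W → W → Prop
  val : ℕ → W → Prop

/-- Satisfaction of a modal formula at a world of a Kripke model. -/
def Satisfies {W : Type} (M : KripkeModel W) : W → Formula → Prop
  | w, .var n => M.val n w
  | _, .fls => False
  | w, .impl a b => Satisfies M w a → Satisfies M w b
  | w, .box a => ∀ v, M.rel w v → Satisfies M v a

/-- Validity of a formula on a Kripke frame. -/
def ValidOnFrame (W : Type) (R : W → W → Prop) (φ : Formula) : Prop :=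
  ∀ (val : ℕ → W → Prop) (w : W), Satisfies ⟨R, val⟩ w φ

/-- A model labeling of (M,w₀) for (N,u₀): a substitution σ such that every formula is
true at (M,w₀) iff its σ-instance is true at (N,u₀). -/
def ModelLabeling {W U : Type} (M : KripkeModel W) (w0 : W) (N : KripkeModel U) (u0 : U)
    (σ : ℕ → Formula) : Prop :=
  ∀ φ : Formula, Satisfies M w0 φ ↔ Satisfies N u0 (φ.subst σ)

/-- A frame labeling of the frame (W,R) with initial node w₀ for the pointed model (N,u₀). -/
def FrameLabeling {W U : Type} (R : W → W → Prop) (w0 : W) (N : KripkeModel U) (u0 : U)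
    (Φ : W → Formula) : Prop :=
  Satisfies N u0 (Φ w0) ∧
  (∀ u, N.rel u0 u → ∀ w, Satisfies N u (Φ w) →
    ∀ w', (Satisfies N u (dia (Φ w')) ↔ R w w')) ∧
  (∀ u, N.rel u0 u → ∃! w, Satisfies N u (Φ w))

def bigOr : List Formula → Formula
  | [] => fls
  | φ :: l => disj φ (bigOr l)

def bigAnd : List Formula → Formula
  | [] => tru
  | φ :: l => conj φ (bigAnd l)

open Classical in
/-- The disjunction ⋁ {Φ w : P w}. -/
noncomputable def labelFormula {W : Type} [Fintype W] (Φ : W → Formula) (P : W → Prop) :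
    Formula :=
  bigOr ((Finset.univ.filter P).toList.map Φ)

/-- Θ_A : the formula asserting that the button pattern is exactly A. -/
noncomputable def Theta {n : ℕ} (b : Fin n → Formula) (A : Finset (Fin n)) : Formula :=
  bigAnd ((Finset.univ : Finset (Fin n)).toList.map
    (fun i => if i ∈ A then box (b i) else neg (box (b i))))

/-- b₀,…,b_{n−1} are independent buttons at u₀: none is pushed (necessary) at u₀, and
necessarily, whenever the button pattern is exactly A, every larger pattern is possible. -/
def IndependentButtons {U : Type} (N : KripkeModel U) (u0 : U) {n : ℕ}
    (b : Fin n → Formula) : Prop :=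
  (∀ i, ¬ Satisfies N u0 (box (b i))) ∧
  ∀ A : Finset (Fin n), ∀ u, N.rel u0 u → Satisfies N u (Theta b A) →
    ∀ A' : Finset (Fin n), A ⊆ A' → Satisfies N u (dia (Theta b A'))

/-- r₀,…,r_{n−1} form a ratchet of length n at u₀. -/
def Ratchet {U : Type} (N : KripkeModel U) (u0 : U) {n : ℕ} (r : Fin n → Formula) : Prop :=
  (∀ i : Fin n, (i.val = 0 → Satisfies N u0 (box (r i))) ∧
      (0 < i.val → ¬ Satisfies N u0 (box (r i)))) ∧
  (∀ u, N.rel u0 u → ∀ i j : Fin n, i < j →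
      Satisfies N u (box (r j)) → Satisfies N u (box (r i))) ∧
  (∀ u, N.rel u0 u → ∀ i : Fin n, 0 < i.val →
      (∀ j : Fin n, Satisfies N u (box (r j)) ↔ j < i) →
        ∃ v, N.rel u v ∧ ∀ j : Fin n, Satisfies N v (box (r j)) ↔ j ≤ i)

/-- A (finite) tree order: a partial order with a least element in which the set of
predecessors of every element is linearly ordered. -/
def IsTreeOrder {W : Type} (R : W → W → Prop) : Prop :=
  IsPartialOrder W R ∧ (∃ r, ∀ x, R r x) ∧ ∀ x a b, R a x → R b x → R a b ∨ R b a

/-- A baled tree order: a partial order with a greatest element t whose removal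
leaves a tree. -/
def IsBaledTreeOrder {W : Type} (R : W → W → Prop) : Prop :=
  IsPartialOrder W R ∧ ∃ t : W, (∀ x, R x t) ∧
    (∃ r, r ≠ t ∧ ∀ x, x ≠ t → R r x) ∧
    (∀ x a b, x ≠ t → R a x → R b x → R a b ∨ R b a)

/-- Height of a node: the number of its strict predecessors. -/
noncomputable def heightOf {W : Type} (R : W → W → Prop) (x : W) : ℕ :=
  Nat.card {y : W // R y x ∧ y ≠ x}

/-- y is an immediate successor of x. -/
def ImmSucc {W : Type} (R : W → W → Prop) (x y : W) : Prop :=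
  R x y ∧ x ≠ y ∧ ∀ z, R x z → R z y → z = x ∨ z = y

def IsMaximal {W : Type} (R : W → W → Prop) (x : W) : Prop := ∀ z, R x z → z = x

/-- A regular finite tree: all maximal elements have the same height, and any two
elements of the same height have the same number of immediate successors. -/
def IsRegularTree {W : Type} (R : W → W → Prop) : Prop :=
  IsTreeOrder R ∧
  (∀ x y, IsMaximal R x → IsMaximal R y → heightOf R x = heightOf R y) ∧
  (∀ x y, heightOf R x = heightOf R y →
    Nat.card {z : W // ImmSucc R x z} = Nat.card {z : W // ImmSucc R y z})

theorem isNormalLogic_generated (Ax : Set Formula) : IsNormalLogic (Generated Ax) where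
  taut φ h := fun _ hL => hL.1.taut φ h
  axK φ ψ := fun _ hL => hL.1.axK φ ψ
  mp φ ψ h₁ h₂ := fun L hL => hL.1.mp φ ψ (h₁ L hL) (h₂ L hL)
  nec φ h := fun L hL => hL.1.nec φ (h L hL)
  subst φ σ h := fun L hL => hL.1.subst φ σ (h L hL)

theorem subset_generated (Ax : Set Formula) : Ax ⊆ Generated Ax :=
  fun _ h _ hL => hL.2 h

theorem generated_subset {Ax L : Set Formula} (hL : IsNormalLogic L) (h : Ax ⊆ L) :
    Generated Ax ⊆ L :=
  fun _ hφ => hφ L ⟨hL, h⟩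

section Satisfaction

variable {W : Type} (M : KripkeModel W) (w : W) (φ ψ : Formula)

theorem satisfies_neg : Satisfies M w (neg φ) ↔ ¬ Satisfies M w φ := Iff.rfl

theorem satisfies_conj : Satisfies M w (conj φ ψ) ↔ Satisfies M w φ ∧ Satisfies M w ψ := by
  simp [conj, neg, Satisfies]

theorem satisfies_disj : Satisfies M w (disj φ ψ) ↔ Satisfies M w φ ∨ Satisfies M w ψ := by
  simp only [disj, neg, Satisfies, imp_false, or_iff_not_imp_left]

theorem satisfies_dia : Satisfies M w (dia φ) ↔ ∃ v, M.rel w v ∧ Satisfies M v φ := by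
  simp only [dia, neg, Satisfies, imp_false, not_forall, not_not, exists_prop]

theorem satisfies_penultimate : Satisfies M w (penultimate φ) ↔
    Satisfies M w φ ∧ (∃ v, M.rel w v ∧ ¬ Satisfies M v φ) ∧
      ∀ v, M.rel w v → ¬ Satisfies M v φ → ∀ u, M.rel v u → ¬ Satisfies M u φ := by
  simp only [penultimate, satisfies_conj, satisfies_dia]
  rfl

theorem satisfies_penultimate_neg : Satisfies M w (penultimate (neg φ)) ↔
    ¬ Satisfies M w φ ∧ (∃ v, M.rel w v ∧ Satisfies M v φ) ∧
      ∀ v, M.rel w v → Satisfies M v φ → ∀ u, M.rel v u → Satisfies M u φ := by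
  simp only [satisfies_penultimate, satisfies_neg, not_not]

theorem satisfies_axGrzStar : Satisfies M w axGrzStar ↔
    ((∃ v, M.rel w v ∧ Satisfies M v pv) → (∃ v, M.rel w v ∧ ¬ Satisfies M v pv) →
      ∃ v, M.rel w v ∧
        (Satisfies M v (penultimate pv) ∨ Satisfies M v (penultimate (neg pv)))) := by
  change (Satisfies M w _ → Satisfies M w _) ↔ _
  simp only [contingent, satisfies_conj, satisfies_dia, satisfies_neg, satisfies_disj, and_imp]

end Satisfaction

/-- A set of formulas containing `L` and closed under modus ponens. -/
structure IsTheory (L T : Set Formula) : Prop where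
  base : L ⊆ T
  mp : ∀ {φ ψ}, impl φ ψ ∈ T → φ ∈ T → ψ ∈ T

namespace IsTheory

variable {L T : Set Formula}

theorem of_taut (hL : IsNormalLogic L) (hT : IsTheory L T) {φ : Formula} (h : Tautology φ) :
    φ ∈ T :=
  hT.base (hL.taut φ h)

/-- The theory obtained by adjoining `ψ` to `T`. -/
theorem adjoin (hL : IsNormalLogic L) (hT : IsTheory L T) (ψ : Formula) :
    IsTheory L {χ | impl ψ χ ∈ T} where
  base χ hχ := by
    refine hT.mp (hT.of_taut hL fun v => ?_) (hT.base hχ)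
    simp only [evalProp]
    cases evalProp v χ <;> simp
  mp {φ χ} h₁ h₂ := by
    refine hT.mp (hT.mp (hT.of_taut hL fun v => ?_) h₁) h₂
    simp only [evalProp]
    cases evalProp v ψ <;> cases evalProp v φ <;> simp

theorem unbox (hL : IsNormalLogic L) (hT : IsTheory L T) : IsTheory L {χ | box χ ∈ T} where
  base χ hχ := hT.base (hL.nec χ hχ)
  mp {φ χ} h₁ h₂ := hT.mp (hT.mp (hT.base (hL.axK φ χ)) h₁) h₂

end IsTheory

/-- A maximal `L`-consistent set. -/
structure IsWorld (L w : Set Formula) : Prop extends IsTheory L w where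
  consistent : fls ∉ w
  complete : ∀ φ, φ ∈ w ∨ neg φ ∈ w

theorem IsTheory.exists_world {L T : Set Formula} (hL : IsNormalLogic L) (hT : IsTheory L T)
    {φ : Formula} (hφ : φ ∉ T) : ∃ w, IsWorld L w ∧ T ⊆ w ∧ φ ∉ w := by
  obtain ⟨M, hTM, hM⟩ := zorn_subset_nonempty {S | IsTheory L S ∧ φ ∉ S} (by
    intro c hc hchain ⟨S₀, hS₀⟩
    refine ⟨⋃₀ c, ⟨⟨fun x hx => ⟨S₀, hS₀, (hc hS₀).1.base hx⟩, ?_⟩, ?_⟩,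
      fun S hS => Set.subset_sUnion_of_mem hS⟩
    · rintro α β ⟨S, hS, h₁⟩ ⟨S', hS', h₂⟩
      rcases hchain.total hS hS' with h | h
      · exact ⟨S', hS', (hc hS').1.mp (h h₁) h₂⟩
      · exact ⟨S, hS, (hc hS).1.mp h₁ (h h₂)⟩
    · rintro ⟨S, hS, h⟩
      exact (hc hS).2 h) T ⟨hT, hφ⟩
  obtain ⟨hMT, hMφ⟩ := hM.prop
  have key : ∀ ψ, ψ ∉ M → impl ψ φ ∈ M := by
    intro ψ hψ
    by_contra h
    have hsub : M ⊆ {χ | impl ψ χ ∈ M} := fun χ hχ =>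
      hMT.mp (hMT.of_taut hL fun v => by simp only [evalProp]; cases evalProp v χ <;> simp) hχ
    refine hψ (hM.le_of_ge ⟨hMT.adjoin hL ψ, h⟩ hsub ?_)
    exact hMT.of_taut hL fun v => by simp [evalProp]
  refine ⟨M, ⟨hMT, fun h => hMφ (hMT.mp (hMT.of_taut hL fun v => by simp [evalProp]) h), ?_⟩,
    hTM, hMφ⟩
  intro ψ
  by_contra! h
  refine hMφ (hMT.mp (hMT.mp (hMT.of_taut hL fun v => ?_) (key _ h.1)) (key _ h.2))
  simp only [evalProp, neg]
  cases evalProp v ψ <;> simp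

/-- The canonical model of a logic, built from its maximal consistent sets. -/
def canonicalModel (L : Set Formula) : KripkeModel {w // IsWorld L w} where
  rel w v := ∀ φ, box φ ∈ w.1 → φ ∈ v.1
  val n w := var n ∈ w.1

theorem satisfies_canonicalModel {L : Set Formula} (hL : IsNormalLogic L) (φ : Formula) :
    ∀ w, Satisfies (canonicalModel L) w φ ↔ φ ∈ w.1 := by
  induction φ with
  | var n => exact fun w => Iff.rfl
  | fls => exact fun w => ⟨False.elim, w.2.consistent⟩
  | impl a b iha ihb =>
    intro w
    simp only [Satisfies, iha, ihb]
    refine ⟨fun h => ?_, fun h => w.2.mp h⟩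
    rcases w.2.complete a with ha | ha
    · refine w.2.mp (w.2.of_taut hL fun v => ?_) (h ha)
      simp only [evalProp]
      cases evalProp v b <;> simp
    · refine w.2.mp (w.2.of_taut hL fun v => ?_) ha
      simp only [evalProp, neg]
      cases evalProp v a <;> simp
  | box a ih =>
    intro w
    simp only [Satisfies, ih]
    refine ⟨fun h => ?_, fun h v hv => hv a h⟩
    by_contra hbox
    obtain ⟨v, hv, hsub, ha⟩ := (w.2.unbox hL).exists_world hL (φ := a) hbox
    exact ha (h ⟨v, hv⟩ fun _ hχ => hsub hχ)

theorem mem_iff_canonicalModel {L : Set Formula} (hL : IsNormalLogic L) (φ : Formula) :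
    φ ∈ L ↔ ∀ w, Satisfies (canonicalModel L) w φ := by
  simp only [satisfies_canonicalModel hL]
  refine ⟨fun h w => w.2.base h, fun h => ?_⟩
  by_contra hφ
  obtain ⟨w, hw, -, hφw⟩ := IsTheory.exists_world hL ⟨subset_rfl, hL.mp _ _⟩ hφ
  exact hφw (h ⟨w, hw⟩)

section

variable {L : Set Formula}

theorem canonicalModel_refl (hL : IsNormalLogic L) (hT : axT ∈ L) (w) :
    (canonicalModel L).rel w w :=
  fun φ h => w.2.mp (w.2.base (hL.subst axT (fun _ => φ) hT)) h

theorem canonicalModel_trans (hL : IsNormalLogic L) (h4 : axFour ∈ L) {u v w}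
    (huv : (canonicalModel L).rel u v) (hvw : (canonicalModel L).rel v w) :
    (canonicalModel L).rel u w :=
  fun φ h => hvw φ (huv _ (u.2.mp (u.2.base (hL.subst axFour (fun _ => φ) h4)) h))

/-- Every substitution instance of the Grzegorczyk axiom holds throughout the canonical model
of a logic containing it. -/
theorem satisfies_axGrz (hL : IsNormalLogic L) (hG : axGrz ∈ L) (φ : Formula) (w) :
    Satisfies (canonicalModel L) w (impl (box (impl (box (impl φ (box φ))) φ)) φ) :=
  (mem_iff_canonicalModel hL _).1 (hL.subst axGrz (fun _ => φ) hG) w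

theorem axT_mem_of_axGrz_mem (hL : IsNormalLogic L) (hG : axGrz ∈ L) : axT ∈ L :=
  (mem_iff_canonicalModel hL _).2 fun w hp =>
    satisfies_axGrz hL hG pv w fun v hv _ => hp v hv

theorem axFour_mem_of_axGrz_mem (hL : IsNormalLogic L) (hG : axGrz ∈ L) : axFour ∈ L := by
  refine (mem_iff_canonicalModel hL _).2 fun w hp => ?_
  have h := satisfies_axGrz hL hG (conj pv (impl (box pv) (box (box pv)))) w
  simp only [Satisfies, satisfies_conj] at h hp ⊢
  refine (h fun v hv hq => ⟨hp v hv, fun hpv x hx y hy => ?_⟩).2 hp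
  by_cases hqx : ∀ y, (canonicalModel L).rel x y → Satisfies (canonicalModel L) y pv
  · exact hqx y hy
  · exact (hq x hx ⟨hpv x hx, fun h' => absurd h' hqx⟩ y hy).1

/-- A true formula is true at some later world after which, once false, it stays false. -/
theorem exists_last_of_axGrz_mem (hL : IsNormalLogic L) (hG : axGrz ∈ L) {φ : Formula} {w}
    (hφ : Satisfies (canonicalModel L) w φ) :
    ∃ v, (canonicalModel L).rel w v ∧ Satisfies (canonicalModel L) v φ ∧
      ∀ x, (canonicalModel L).rel v x → ¬ Satisfies (canonicalModel L) x φ →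
        ∀ y, (canonicalModel L).rel x y → ¬ Satisfies (canonicalModel L) y φ := by
  by_contra! h
  refine satisfies_axGrz hL hG (neg φ) w (fun v hv hbox hφv => ?_) hφ
  obtain ⟨x, hx, hnx, y, hy, hφy⟩ := h v hv hφv
  exact hbox x hx hnx y hy hφy

theorem exists_penultimate_of_axGrz_mem (hL : IsNormalLogic L) (hG : axGrz ∈ L) {φ : Formula} {w}
    (hφ : Satisfies (canonicalModel L) w φ)
    (hn : ∃ v, (canonicalModel L).rel w v ∧ ¬ Satisfies (canonicalModel L) v φ) :
    ∃ v, (canonicalModel L).rel w v ∧ (Satisfies (canonicalModel L) v (penultimate φ) ∨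
      Satisfies (canonicalModel L) v (penultimate (neg φ))) := by
  have htrans := @canonicalModel_trans L hL (axFour_mem_of_axGrz_mem hL hG)
  obtain ⟨v, hwv, hv, hlast⟩ := exists_last_of_axGrz_mem hL hG (φ := conj φ (dia (neg φ))) (w := w)
    (by simpa only [satisfies_conj, satisfies_dia, satisfies_neg] using ⟨hφ, hn⟩)
  simp only [satisfies_conj, satisfies_dia, satisfies_neg] at hv hlast
  simp only [satisfies_penultimate, satisfies_neg, not_not]
  by_cases hpen : ∀ x, (canonicalModel L).rel v x → ¬ Satisfies (canonicalModel L) x φ →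
      ∀ y, (canonicalModel L).rel x y → ¬ Satisfies (canonicalModel L) y φ
  · exact ⟨v, hwv, .inl ⟨hv.1, hv.2, hpen⟩⟩
  · push Not at hpen
    obtain ⟨x, hvx, hx, y, hxy, hy⟩ := hpen
    refine ⟨x, htrans hwv hvx, .inr ⟨hx, ⟨y, hxy, hy⟩, fun z hxz hz u hzu => ?_⟩⟩
    by_contra hu
    exact hlast x hvx (fun h => hx h.1) z hxz ⟨hz, u, hzu, hu⟩

theorem axGrzStar_mem_of_axGrz_mem (hL : IsNormalLogic L) (hG : axGrz ∈ L) : axGrzStar ∈ L := by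
  refine (mem_iff_canonicalModel hL _).2 fun w => (satisfies_axGrzStar _ _).2 fun hc hn => ?_
  by_cases hp : Satisfies (canonicalModel L) w pv
  · exact exists_penultimate_of_axGrz_mem hL hG hp hn
  · obtain ⟨v, hv, h⟩ := exists_penultimate_of_axGrz_mem hL hG (φ := neg pv) hp
      (by simpa only [satisfies_neg, not_not] using hc)
    refine ⟨v, hv, h.symm.imp_left fun h => ?_⟩
    simpa only [satisfies_penultimate, satisfies_neg, not_not] using h

theorem axGrz_mem_of_axGrzStar_mem (hL : IsNormalLogic L) (hT : axT ∈ L) (h4 : axFour ∈ L)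
    (hS : axGrzStar ∈ L) : axGrz ∈ L := by
  refine (mem_iff_canonicalModel hL _).2 fun w hw => ?_
  by_contra hp
  have hrefl := canonicalModel_refl hL hT
  have htrans := @canonicalModel_trans L hL h4
  have hstar := (satisfies_axGrzStar _ _).1 ((mem_iff_canonicalModel hL _).1 hS w)
  have step : ∀ v, (canonicalModel L).rel w v → ¬ Satisfies (canonicalModel L) v pv →
      ∃ x, (canonicalModel L).rel v x ∧ Satisfies (canonicalModel L) x pv ∧
        ∃ y, (canonicalModel L).rel x y ∧ ¬ Satisfies (canonicalModel L) y pv := by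
    intro v hv hnv
    by_contra! h
    exact hnv (hw v hv h)
  obtain ⟨x, hx, hpx, -⟩ := step w (hrefl w) hp
  obtain ⟨v, hwv, h⟩ := hstar ⟨x, hx, hpx⟩ ⟨w, hrefl w, hp⟩
  rw [satisfies_penultimate, satisfies_penultimate_neg] at h
  rcases h with ⟨-, ⟨y, hvy, hy⟩, hlast⟩ | ⟨hv, -, hlast⟩
  · obtain ⟨z, hyz, hz, -⟩ := step y (htrans hwv hvy) hy
    exact hlast y hvy hy z hyz hz
  · obtain ⟨y, hvy, hy, z, hyz, hz⟩ := step v hwv hv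
    exact hz (hlast y hvy hy z hyz)

end

/-- The normal modal logic generated by the S4 axioms together with Grz*
equals Grz; consequently Grz is the smallest normal modal logic containing the S4 axioms
in which every contingency possibly attains a penultimate truth-value (i.e. containing Grz*). -/
theorem statement0 :
    S4GrzStar = Grz ∧
    (axT ∈ Grz ∧ axFour ∈ Grz ∧ axGrzStar ∈ Grz ∧
      ∀ L : Set Formula, IsNormalLogic L →
        axT ∈ L → axFour ∈ L → axGrzStar ∈ L → Grz ⊆ L) := by
  have hN := isNormalLogic_generated {axGrz}
  have hG : axGrz ∈ Grz := subset_generated _ rfl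
  have hT := axT_mem_of_axGrz_mem hN hG
  have h4 := axFour_mem_of_axGrz_mem hN hG
  have hS := axGrzStar_mem_of_axGrz_mem hN hG
  have hmin : ∀ L : Set Formula, IsNormalLogic L →
      axT ∈ L → axFour ∈ L → axGrzStar ∈ L → Grz ⊆ L := fun L hL hT h4 hS =>
    generated_subset hL (Set.singleton_subset_iff.2 (axGrz_mem_of_axGrzStar_mem hL hT h4 hS))
  refine ⟨Set.Subset.antisymm (generated_subset hN ?_) (hmin _ (isNormalLogic_generated _)
    (subset_generated _ ?_) (subset_generated _ ?_) (subset_generated _ ?_)), hT, h4, hS, hmin⟩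
  · rintro φ (rfl | rfl | rfl)
    exacts [hT, h4, hS]
  all_goals simp

end GrzPaper
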